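/- Let a, b ∈ ℤ and suppose the polynomial F(x) = x⁸ + a·x⁴ + b is monogenic. Suppose that none of b, b(a²−4b), and 4b−a² is a perfect square (the square of an integer), and that at least one of the following holds: (i) −b = c² for some integer c ≥ 0 and 2(a²−4b)·c is a nonzero perfect square; or (ii) −b(a²−4b) = d² for some integer d ≥ 0 and −4b + 2d is a nonzero perfect square. Then (a, b) ∈ {(2, −1), (−2, −1), (0, −2)}, i.e., F(x) is one of x⁸ + 2x⁴ − 1, x⁸ − 2x⁴ − 1, x⁸ − 2. -/

import Mathlib

open Polynomial

/-- A monic polynomial `f ∈ ℤ[x]` is *monogenic* if it is irreducible over `ℚ` and,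
for any number field `K` generated over `ℚ` by a root `θ` of `f`, the ring `ℤ[θ]`
is the full ring of integers (the integral closure of `ℤ`) of `K`. -/
def IsMonogenic (f : Polynomial ℤ) : Prop :=
  f.Monic ∧ Irreducible (f.map (Int.castRingHom ℚ)) ∧
    ∀ (K : Type) [Field K] [NumberField K] (θ : K),
      Polynomial.aeval θ f = 0 →
      Algebra.adjoin ℚ {θ} = (⊤ : Subalgebra ℚ K) →
      Algebra.adjoin ℤ {θ} = integralClosure ℤ K

/-- An irreducible polynomial over `ℚ` has a root generating a number field. -/
lemma exists_numberField_adjoin_root_eq_top {g : ℚ[X]} (hg : Irreducible g) :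
    ∃ (K : Type) (_ : Field K) (_ : NumberField K) (θ : K),
      aeval θ g = 0 ∧ Algebra.adjoin ℚ {θ} = (⊤ : Subalgebra ℚ K) := by
  have : Fact (Irreducible g) := ⟨hg⟩
  have : FiniteDimensional ℚ (AdjoinRoot g) := (AdjoinRoot.powerBasis hg.ne_zero).finite
  refine ⟨AdjoinRoot g, inferInstance,
    { to_charZero := algebraRat.charZero _, to_finiteDimensional := ?_ }, AdjoinRoot.root g, ?_, ?_⟩
  · exact this
  · convert AdjoinRoot.eval₂_root g using 1
    rw [aeval_def]
    congr 1
  · exact AdjoinRoot.adjoinRoot_eq_top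

/-- If `f` is monogenic with root `θ` and `Q(θ) / n` is integral, where `Q` has smaller degree
than `f`, then `n` divides every coefficient of `Q`. -/
lemma IsMonogenic.dvd_coeff {f : ℤ[X]} (hf : IsMonogenic f) {Q : ℤ[X]}
    (hQ : Q.degree < f.degree) {n : ℤ} (hn : n ≠ 0)
    (hint : ∀ (K : Type) [Field K] [NumberField K] (θ : K), aeval θ f = 0 →
      IsIntegral ℤ (aeval θ Q / (n : K))) (i : ℕ) : n ∣ Q.coeff i := by
  obtain ⟨hmonic, hirr, hmax⟩ := hf
  obtain ⟨K, _, _, θ, hθ, htop⟩ := exists_numberField_adjoin_root_eq_top hirr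
  have hmap (R : ℤ[X]) : aeval θ (R.map (Int.castRingHom ℚ)) = aeval θ R :=
    aeval_map_algebraMap ℚ θ R
  have hroot : aeval θ f = 0 := by rwa [← hmap]
  have hmem : aeval θ Q / (n : K) ∈ Algebra.adjoin ℤ {θ} := by
    rw [hmax K θ hroot htop]
    exact hint K θ hroot
  rw [Algebra.adjoin_singleton_eq_range_aeval] at hmem
  obtain ⟨P, hP : aeval θ P = _⟩ := hmem
  have hnK : (n : K) ≠ 0 := Int.cast_ne_zero.2 hn
  have hzero : aeval θ (C n * (P %ₘ f) - Q) = 0 := by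
    have hPmod : aeval θ (P %ₘ f) = aeval θ P := by
      conv_rhs => rw [← modByMonic_add_div P f]
      simp [hroot]
    rw [map_sub, map_mul, aeval_C, hPmod, hP, algebraMap_int_eq, eq_intCast,
      mul_div_cancel₀ _ hnK, sub_self]
  have hdvd : f ∣ C n * (P %ₘ f) - Q := by
    refine (map_dvd_map (Int.castRingHom ℚ) Int.cast_injective hmonic).1 ?_
    rw [minpoly.eq_of_irreducible_of_monic hirr hθ (hmonic.map _)]
    exact minpoly.dvd ℚ θ (by rwa [hmap])
  have hdeg : (C n * (P %ₘ f) - Q).degree < f.degree := by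
    refine (degree_sub_le _ _).trans_lt (max_lt ?_ hQ)
    rw [degree_C_mul hn]
    exact degree_modByMonic_lt P hmonic
  have heq : C n * (P %ₘ f) = Q := by
    by_contra hne
    exact hmonic.not_dvd_of_degree_lt (sub_ne_zero.2 hne) hdeg hdvd
  exact ⟨(P %ₘ f).coeff i, by rw [← coeff_C_mul, heq]⟩

lemma degree_X_pow_eight_add (a b : ℤ) : (X ^ 8 + C a * X ^ 4 + C b : ℤ[X]).degree = 8 := by
  compute_degree!

/-- The constant term of a monogenic `x⁸ + ax⁴ + b` is squarefree. -/
lemma IsMonogenic.squarefree_const {a b : ℤ}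
    (h : IsMonogenic (X ^ 8 + C a * X ^ 4 + C b)) (hb : b ≠ 0) : Squarefree b := by
  rintro n ⟨k, rfl⟩
  have hn : n ≠ 0 := by rintro rfl; simp at hb
  have hdvd := h.dvd_coeff (Q := X ^ 7 + C a * X ^ 3) (n := n) ?_ hn ?_ 7
  · simpa [coeff_X, coeff_C, coeff_X_pow, isUnit_iff_dvd_one] using hdvd
  · rw [degree_X_pow_eight_add]
    have : (X ^ 7 + C a * X ^ 3 : ℤ[X]).degree = 7 := by compute_degree!
    rw [this]
    norm_num
  · intro K _ _ θ hθ
    have hroot : θ ^ 8 + a * θ ^ 4 + n * n * k = 0 := by simpa using hθ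
    have hnK : (n : K) ≠ 0 := Int.cast_ne_zero.2 hn
    have hθint : IsIntegral ℤ θ :=
      ⟨_, h.1, by rwa [← aeval_def]⟩
    refine IsIntegral.of_pow (n := 4) (by norm_num) ?_
    have hpow : (aeval θ (X ^ 7 + C a * X ^ 3 : ℤ[X]) / (n : K)) ^ 4 =
        ((-(n ^ 2 * k ^ 3) : ℤ) : K) * (θ ^ 4 + (a : ℤ)) := by
      simp only [map_add, map_mul, map_pow, aeval_X, aeval_C, algebraMap_int_eq, Int.coe_castRingHom]
      rw [div_pow, div_eq_iff (pow_ne_zero _ hnK)]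
      have hu : θ ^ 4 * (θ ^ 4 + a) = -(n * n * k) := by linear_combination hroot
      calc (θ ^ 7 + a * θ ^ 3) ^ 4 = (θ ^ 4 * (θ ^ 4 + a)) ^ 3 * (θ ^ 4 + a) := by ring
        _ = _ := by rw [hu]; push_cast; ring
    rw [hpow]
    exact isIntegral_algebraMap.mul ((hθint.pow 4).add isIntegral_algebraMap)

/-- If `x⁸ + ax⁴ + b` is monogenic, then a square `n²` dividing `a² - 4b` satisfies `n ∣ 2`. -/
lemma IsMonogenic.dvd_two_of_sq_dvd {a b n : ℤ}
    (h : IsMonogenic (X ^ 8 + C a * X ^ 4 + C b)) (hn : n ≠ 0)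
    (hdisc : n ^ 2 ∣ a ^ 2 - 4 * b) : n ∣ 2 := by
  obtain ⟨D, hD⟩ := hdisc
  have hdvd := h.dvd_coeff (Q := C 2 * X ^ 4 + C a) (n := n) ?_ hn ?_ 4
  · simpa [-eq_intCast, coeff_C, coeff_X_pow] using hdvd
  · rw [degree_X_pow_eight_add]
    have : (C 2 * X ^ 4 + C a : ℤ[X]).degree = 4 := by compute_degree!
    rw [this]
    norm_num
  · intro K _ _ θ hθ
    have hroot : θ ^ 8 + a * θ ^ 4 + b = 0 := by simpa using hθ
    have hnK : (n : K) ≠ 0 := Int.cast_ne_zero.2 hn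
    have hDK : (a : K) ^ 2 - 4 * b = n ^ 2 * D := by exact_mod_cast hD
    refine IsIntegral.of_pow (n := 2) (by norm_num) ?_
    have hpow : (aeval θ (C 2 * X ^ 4 + C a : ℤ[X]) / (n : K)) ^ 2 = (D : K) := by
      simp only [map_add, map_mul, map_pow, aeval_X, aeval_C, algebraMap_int_eq, Int.coe_castRingHom]
      rw [div_pow, div_eq_iff (pow_ne_zero _ hnK)]
      push_cast
      linear_combination 4 * hroot + hDK
    rw [hpow]
    exact isIntegral_algebraMap

theorem stmt_10 (a b : ℤ)
    (hmono : IsMonogenic (X ^ 8 + C a * X ^ 4 + C b))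
    (hb : ¬ IsSquare b)
    (hb2 : ¬ IsSquare (b * (a ^ 2 - 4 * b)))
    (hb3 : ¬ IsSquare (4 * b - a ^ 2))
    (hcase :
      (∃ c : ℤ, 0 ≤ c ∧ -b = c ^ 2 ∧
        IsSquare (2 * (a ^ 2 - 4 * b) * c) ∧ 2 * (a ^ 2 - 4 * b) * c ≠ 0) ∨
      (∃ d : ℤ, 0 ≤ d ∧ -(b * (a ^ 2 - 4 * b)) = d ^ 2 ∧
        IsSquare (-4 * b + 2 * d) ∧ -4 * b + 2 * d ≠ 0)) :
    (a = 2 ∧ b = -1) ∨ (a = -2 ∧ b = -1) ∨ (a = 0 ∧ b = -2) := by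
  have hb0 : b ≠ 0 := by rintro rfl; exact hb (IsSquare.zero)
  have hsf := hmono.squarefree_const hb0
  have even_of_sq {x y : ℤ} (hxy : x ^ 2 = 2 * y) : ∃ z, x = 2 * z :=
    Int.prime_two.dvd_of_dvd_pow ⟨y, hxy⟩
  rcases hcase with ⟨c, hc, hbc, ⟨s, hs⟩, -⟩ | ⟨d, hd, hbd, ⟨s, hs⟩, hne⟩
  · have hc1 : c = 1 := by
      rcases Int.isUnit_iff.1 (hsf c ⟨-1, by linear_combination -hbc⟩) with h | h <;> omega
    subst hc1
    obtain rfl : b = -1 := by linarith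
    obtain ⟨r, rfl⟩ := even_of_sq (x := s) (y := a ^ 2 + 4) (by linear_combination -hs)
    obtain ⟨k, rfl⟩ := even_of_sq (x := a) (y := r ^ 2 - 2) (by linarith)
    obtain ⟨t, rfl⟩ := even_of_sq (x := r) (y := k ^ 2 + 1) (by linarith)
    have ht0 : t ≠ 0 := by rintro rfl; nlinarith [sq_nonneg k]
    have ht : 2 * t ∣ 2 * 1 :=
      hmono.dvd_two_of_sq_dvd (by simpa using ht0) ⟨2, by linarith⟩
    have ht1 : t ^ 2 = 1 := by
      rcases Int.isUnit_iff.1 (isUnit_of_dvd_one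
        ((mul_dvd_mul_iff_left two_ne_zero).1 ht)) with rfl | rfl <;> norm_num
    have hk : k ^ 2 = 1 := by linarith
    rcases sq_eq_one_iff.1 hk with rfl | rfl <;> simp
  · obtain ⟨e, rfl⟩ : b ∣ d := hsf.isRadical 2 d ⟨-(a ^ 2 - 4 * b), by linear_combination -hbd⟩
    have hdisc : a ^ 2 - 4 * b = -(b * e ^ 2) :=
      mul_left_cancel₀ hb0 (by linear_combination -hbd)
    have he0 : e ≠ 0 := by
      rintro rfl
      exact hb2 (by rw [hdisc]; simp)
    have he : e ∣ 2 := hmono.dvd_two_of_sq_dvd he0 ⟨-b, by linear_combination hdisc⟩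
    have hle := Int.le_of_dvd two_pos he
    have hge := Int.le_of_dvd two_pos (neg_dvd.2 he)
    have hpos : 0 ≤ -4 * b + 2 * (b * e) := hs ▸ mul_self_nonneg s
    obtain rfl | rfl | rfl | rfl : e = 1 ∨ e = -1 ∨ e = 2 ∨ e = -2 := by omega
    · exact absurd (show b = 0 by linarith [sq_nonneg a]) hb0
    · exact absurd (show b = 0 by linarith [sq_nonneg a]) hb0
    · omega
    · obtain rfl : a = 0 := pow_eq_zero_iff two_ne_zero |>.1 (by linarith)
      obtain ⟨r, rfl⟩ := even_of_sq (x := s) (y := -4 * b) (by linarith)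
      obtain ⟨t, rfl⟩ := even_of_sq (x := r) (y := -b) (by linarith)
      have ht : IsUnit t := hsf t ⟨-2, by linarith⟩
      rcases Int.isUnit_iff.1 ht with rfl | rfl <;> omega
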